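/- Let F be a finite field of order q = p^f and θ_α ∈ GL(4,F) as defined. For every α ∈ F \ {0}: if p > 3 then θ_α has order p, while if p ∈ {2,3} then θ_α has order p². Moreover, for every α ∈ F, the inverse θ_α^{-1} is the matrix with 1's on the diagonal and entries α at (2,1), −α at (3,2), α² at (4,2), −α at (4,3), and 0 elsewhere. -/

import Mathlib

open Matrix

variable (F : Type) [Field F]

/-- The matrix `t_{a,b,c}`: 1's on the diagonal, `-c` in position (2,1), `b` in (3,1),
`a` in (4,1), `b` in (4,2), `c` in (4,3), and 0 elsewhere. -/
def tMat (a b c : F) : Matrix (Fin 4) (Fin 4) F :=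
  !![1, 0, 0, 0;
     -c, 1, 0, 0;
     b, 0, 1, 0;
     a, b, c, 1]

lemma tMat_mul_neg (a b c : F) : tMat F a b c * tMat F (-a) (-b) (-c) = 1 := by
  ext i j
  fin_cases i <;> fin_cases j <;>
    simp [tMat, Matrix.mul_apply, Fin.sum_univ_four, Matrix.one_apply,
      Matrix.vecHead, Matrix.vecTail] <;> ring

/-- The element `t_{a,b,c}` of `GL(4,F)`. -/
def tGL (a b c : F) : GL (Fin 4) F :=
  ⟨tMat F a b c, tMat F (-a) (-b) (-c), tMat_mul_neg F a b c, by
    simpa using tMat_mul_neg F (-a) (-b) (-c)⟩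

/-- The matrix `θ_α`: 1's on the diagonal, `-α` in position (2,1), `-α²` in (3,1),
`α` in (3,2), `α` in (4,3), and 0 elsewhere. -/
def thetaMat (α : F) : Matrix (Fin 4) (Fin 4) F :=
  !![1, 0, 0, 0;
     -α, 1, 0, 0;
     -α^2, α, 1, 0;
     0, 0, α, 1]

def thetaInvMat (α : F) : Matrix (Fin 4) (Fin 4) F :=
  !![1, 0, 0, 0;
     α, 1, 0, 0;
     0, -α, 1, 0;
     0, α^2, -α, 1]

/-- The element `θ_α` of `GL(4,F)`. -/
def thetaGL (α : F) : GL (Fin 4) F :=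
  ⟨thetaMat F α, thetaInvMat F α,
   by ext i j; fin_cases i <;> fin_cases j <;>
        simp [thetaMat, thetaInvMat, Matrix.mul_apply, Fin.sum_univ_four, Matrix.one_apply,
          Matrix.vecHead, Matrix.vecTail] <;> ring,
   by ext i j; fin_cases i <;> fin_cases j <;>
        simp [thetaMat, thetaInvMat, Matrix.mul_apply, Fin.sum_univ_four, Matrix.one_apply,
          Matrix.vecHead, Matrix.vecTail] <;> ring⟩

/-- Binomial formula for the powers of `θ_α = 1 + N`, where `N ^ 4 = 0`. -/
lemma thetaMat_pow (α : F) (n : ℕ) :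
    thetaMat F α ^ n =
      !![1, 0, 0, 0;
         -(n * α), 1, 0, 0;
         -((n + n.choose 2) * α ^ 2), n * α, 1, 0;
         -((n.choose 2 + n.choose 3) * α ^ 3), n.choose 2 * α ^ 2, n * α, 1] := by
  induction n with
  | zero =>
    ext i j
    fin_cases i <;> fin_cases j <;> simp
  | succ n ih =>
    rw [pow_succ, ih]
    ext i j
    fin_cases i <;> fin_cases j <;>
      simp [thetaMat, Matrix.mul_apply, Fin.sum_univ_four, Nat.choose_succ_succ' n 1,
        Nat.choose_succ_succ' n 2] <;> ring

lemma thetaGL_pow_eq_one {α : F} (n : ℕ) (h1 : (n : F) = 0) (h2 : (n.choose 2 : F) = 0)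
    (h3 : (n.choose 3 : F) = 0) : thetaGL F α ^ n = 1 := by
  apply Units.ext
  rw [Units.val_pow_eq_pow_val]
  change thetaMat F α ^ n = 1
  rw [thetaMat_pow, h1, h2, h3]
  ext i j
  fin_cases i <;> fin_cases j <;> simp

lemma thetaGL_pow_ne_one {α : F} (hα : α ≠ 0) (n : ℕ)
    (h : (n : F) ≠ 0 ∨ (n.choose 2 : F) ≠ 0 ∨ (n.choose 2 + n.choose 3 : F) ≠ 0) :
    thetaGL F α ^ n ≠ 1 := by
  intro hn
  have hM : thetaMat F α ^ n = 1 := congrArg Units.val hn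
  rw [thetaMat_pow] at hM
  have h21 := congrFun (congrFun hM 1) 0
  have h42 := congrFun (congrFun hM 3) 1
  have h41 := congrFun (congrFun hM 3) 0
  simp [hα] at h21 h42
  simp only [Matrix.one_apply] at h41
  simp [hα, -neg_add_rev] at h41
  rcases h with h | h | h
  exacts [h h21, h h42, h h41]

/-- For `α ≠ 0`: if `p > 3` then `θ_α` has order `p`; if `p ∈ {2,3}` then `θ_α` has
order `p²`. Moreover, for every `α`, `θ_α⁻¹` is the stated matrix. -/
theorem thetaGL_order_and_inv (p fdeg : ℕ) (hp : p.Prime) [Fintype F]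
    (hF : Fintype.card F = p ^ fdeg) :
    (∀ α : F, α ≠ 0 →
      (3 < p → orderOf (thetaGL F α) = p) ∧
      ((p = 2 ∨ p = 3) → orderOf (thetaGL F α) = p ^ 2)) ∧
    (∀ α : F, (((thetaGL F α)⁻¹ : GL (Fin 4) F) : Matrix (Fin 4) (Fin 4) F) =
      !![1, 0, 0, 0;
         α, 1, 0, 0;
         0, -α, 1, 0;
         0, α ^ 2, -α, 1]) := by
  have hp0 : (p : F) = 0 := by
    have h := Nat.cast_card_eq_zero F
    rw [hF, Nat.cast_pow] at h
    exact eq_zero_of_pow_eq_zero h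
  have cast_eq_zero_of_dvd {m : ℕ} (h : p ∣ m) : (m : F) = 0 := by
    obtain ⟨k, rfl⟩ := h
    rw [Nat.cast_mul, hp0, zero_mul]
  have : Fact p.Prime := ⟨hp⟩
  refine ⟨fun α hα => ⟨fun h3 => ?_, fun h => ?_⟩, fun α => rfl⟩
  · apply orderOf_eq_prime
    · exact thetaGL_pow_eq_one F p hp0
        (cast_eq_zero_of_dvd (hp.dvd_choose_self two_ne_zero (by lia)))
        (cast_eq_zero_of_dvd (hp.dvd_choose_self three_ne_zero h3))
    · simpa using thetaGL_pow_ne_one F hα 1 (by simp)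
  · apply orderOf_eq_prime_pow (n := 1)
    · rw [pow_one]
      apply thetaGL_pow_ne_one F hα
      rcases h with rfl | rfl
      · right; left
        simp
      · right; right
        have h3 : (3 : F) = 0 := by simpa using hp0
        simp [Nat.choose, h3]
    · rcases h with rfl | rfl <;>
        exact thetaGL_pow_eq_one F _ (cast_eq_zero_of_dvd (by decide))
          (cast_eq_zero_of_dvd (by decide)) (cast_eq_zero_of_dvd (by decide))
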